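/- arXiv:2011.03517 — 3 statements merged into one kernel-verified Lean document; each statement's English description precedes it below -/
import Mathlib

section
/- Subtracting a cycle from an obligation network does not change the vector of net positions: if L is an n×n nominal liabilities matrix, k ≥ 2, v : ZMod k → Fin n is injective, p ≥ 0, and C is the cycle matrix assigning weight p to each edge (v a, v (a+1)) and 0 elsewhere, then the net position vector of L − C equals the net position vector of L, i.e. for all i, (∑ j, (L − C) j i) − (∑ j, (L − C) i j) = (∑ j, L j i) − (∑ j, L i j). -/
/- The cycle matrix of a cycle of length `k` given by `v : ZMod k → Fin n`, with
common edge weight `p`: entry `p` at each position `(v a, v (a+1))`, `0` elsewhere. -/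
open Classical in
noncomputable def cycleMatrix (n k : ℕ) (v : ZMod k → Fin n) (p : ℝ) :
    Matrix (Fin n) (Fin n) ℝ :=
  fun i j => if ∃ a : ZMod k, i = v a ∧ j = v (a + 1) then p else 0

open Classical in
theorem cycleMatrix_row_sum {n k : ℕ} {v : ZMod k → Fin n} (hv : Function.Injective v)
    (p : ℝ) (i : Fin n) :
    ∑ j, cycleMatrix n k v p i j = if i ∈ Set.range v then p else 0 := by
  split_ifs with h
  · obtain ⟨a, rfl⟩ := h
    have hentry (j : Fin n) :
        cycleMatrix n k v p (v a) j = if j = v (a + 1) then p else 0 := by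
      simp [cycleMatrix, hv.eq_iff]
    simp [hentry]
  · refine Finset.sum_eq_zero fun j _ => if_neg ?_
    rintro ⟨a, rfl, -⟩
    exact h ⟨a, rfl⟩

open Classical in
theorem cycleMatrix_col_sum {n k : ℕ} {v : ZMod k → Fin n} (hv : Function.Injective v)
    (p : ℝ) (i : Fin n) :
    ∑ j, cycleMatrix n k v p j i = if i ∈ Set.range v then p else 0 := by
  split_ifs with h
  · obtain ⟨a, rfl⟩ := h
    have hentry (j : Fin n) :
        cycleMatrix n k v p j (v a) = if j = v (a - 1) then p else 0 := by
      simp only [cycleMatrix, hv.eq_iff, ← sub_eq_iff_eq_add, exists_eq_right']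
    simp [hentry]
  · refine Finset.sum_eq_zero fun j _ => if_neg ?_
    rintro ⟨a, -, rfl⟩
    exact h ⟨a + 1, rfl⟩

/-- Subtracting a cycle from an obligation network does not change
the vector of net positions: the net position vector of `L − C` equals the net
position vector of `L`. -/
theorem subtract_cycle_preserves_net_positions {n k : ℕ}
    (L : Matrix (Fin n) (Fin n) ℝ)
    (hL : ∀ i j, 0 ≤ L i j) (hLdiag : ∀ i, L i i = 0)
    (hk : 2 ≤ k) (v : ZMod k → Fin n) (hv : Function.Injective v)
    (p : ℝ) (hp : 0 ≤ p)
    (C : Matrix (Fin n) (Fin n) ℝ) (hC : C = cycleMatrix n k v p) :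
    ∀ i, (∑ j, (L - C) j i) - (∑ j, (L - C) i j) = (∑ j, L j i) - (∑ j, L i j) := by
  intro i
  subst hC
  simp only [Matrix.sub_apply, Finset.sum_sub_distrib, cycleMatrix_row_sum hv,
    cycleMatrix_col_sum hv]
  ring
end

section
/- If M minimizes the Grandsum among all feasible flows, then T = L − M is a maximum-weight balanced payment subsystem: let S = {M : Matrix (Fin n) (Fin n) ℝ | ∀ i j, 0 ≤ M i j ≤ L i j, and ∀ i, (∑ j, M i j) − (∑ j, M j i) = (∑ j, L i j) − (∑ j, L j i)}, and suppose M ∈ S satisfies μ(M) ≤ μ(M') for all M' ∈ S, where μ denotes the sum of all matrix entries. Then for every matrix T' with 0 ≤ T' i j ≤ L i j for all i, j and (∑ j, T' i j) − (∑ j, T' j i) = 0 for all i, one has μ(T') ≤ μ(L − M). -/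
/-- The Grandsum of a matrix: the sum of all its entries. -/
def grandsum {n : ℕ} (M : Matrix (Fin n) (Fin n) ℝ) : ℝ := ∑ i, ∑ j, M i j

theorem grandsum_sub {n : ℕ} (A B : Matrix (Fin n) (Fin n) ℝ) :
    grandsum (A - B) = grandsum A - grandsum B := by
  simp [grandsum, Finset.sum_sub_distrib]

/-- If `M` minimizes the Grandsum among all feasible flows for `L`,
then `T = L − M` is a maximum-weight balanced payment subsystem: every balanced
subsystem `T'` of `L` satisfies `μ(T') ≤ μ(L − M)`. -/
theorem min_flow_gives_max_weight_balanced_subsystem {n : ℕ}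
    (L : Matrix (Fin n) (Fin n) ℝ)
    (hL : ∀ i j, 0 ≤ L i j) (hLdiag : ∀ i, L i i = 0)
    (S : Set (Matrix (Fin n) (Fin n) ℝ))
    (hS : S = {M | (∀ i j, 0 ≤ M i j ∧ M i j ≤ L i j) ∧
      ∀ i, (∑ j, M i j) - (∑ j, M j i) = (∑ j, L i j) - (∑ j, L j i)})
    (M : Matrix (Fin n) (Fin n) ℝ) (hM : M ∈ S)
    (hmin : ∀ M' ∈ S, grandsum M ≤ grandsum M') :
    ∀ T' : Matrix (Fin n) (Fin n) ℝ,
      (∀ i j, 0 ≤ T' i j ∧ T' i j ≤ L i j) →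
      (∀ i, (∑ j, T' i j) - (∑ j, T' j i) = 0) →
      grandsum T' ≤ grandsum (L - M) := by
  intro T' hT' hbal
  have hmem : L - T' ∈ S := by
    rw [hS]
    refine ⟨fun i j => ?_, fun i => ?_⟩
    · obtain ⟨h0, h1⟩ := hT' i j
      rw [Matrix.sub_apply]
      constructor <;> linarith
    · simp only [Matrix.sub_apply, Finset.sum_sub_distrib]
      linarith [hbal i]
  have hle := hmin _ hmem
  rw [grandsum_sub] at hle ⊢
  linarith
end

section
/- A balanced obligation network is composed of cycles only: if T is an n×n real matrix with nonnegative entries, zero diagonal, and zero net position at every node, i.e. (∑ j, T i j) − (∑ j, T j i) = 0 for all i, then T can be written as a finite sum of cycle matrices, i.e. there exist finitely many triples (k, v, p) with k ≥ 2, v : ZMod k → Fin n injective, and p > 0 such that T equals the sum of the corresponding cycle matrices, where the cycle matrix of (k, v, p) has entry p at each position (v a, v (a+1)) for a : ZMod k and 0 elsewhere. -/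
open Classical in
lemma cycleMatrix_eq_sum {n k : ℕ} [NeZero k] {v : ZMod k → Fin n} (hv : Function.Injective v)
    (p : ℝ) (i j : Fin n) :
    cycleMatrix n k v p i j = ∑ a : ZMod k, if i = v a ∧ j = v (a + 1) then p else 0 := by
  unfold cycleMatrix
  split_ifs with h
  · obtain ⟨a, rfl, rfl⟩ := h
    rw [Finset.sum_eq_single a]
    · simp
    · intro b _ hb
      exact if_neg fun h => hb (hv h.1.symm)
    · simp
  · push Not at h
    exact (Finset.sum_eq_zero fun a _ => if_neg fun h' => h a h'.1 h'.2).symm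

lemma cycleMatrix_row_sum_eq_col_sum {n k : ℕ} [NeZero k] {v : ZMod k → Fin n}
    (hv : Function.Injective v) (p : ℝ) (i : Fin n) :
    ∑ j, cycleMatrix n k v p i j = ∑ j, cycleMatrix n k v p j i := by
  classical
  simp only [cycleMatrix_eq_sum hv]
  rw [Finset.sum_comm, Finset.sum_comm (s := Finset.univ (α := Fin n))]
  simp only [ite_and, Finset.sum_ite_irrel, Finset.sum_ite_eq',
    Finset.sum_const_zero, Finset.mem_univ, if_true]
  exact (Equiv.sum_comp (Equiv.addRight (1 : ZMod k)) fun a => if i = v a then p else 0).symm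

/-- A self-map `f` of a finite type has a cycle in the forward orbit of any point. -/
lemma exists_injective_zmod_orbit {α : Type*} [Finite α] (f : α → α) (x₀ : α) :
    ∃ (k : ℕ) (v : ZMod k → α), 0 < k ∧ Function.Injective v ∧
      (∀ a, v (a + 1) = f (v a)) ∧ ∀ a, ∃ m, v a = f^[m] x₀ := by
  obtain ⟨x, ⟨m, rfl⟩, hx⟩ : ∃ x, (∃ m, x = f^[m] x₀) ∧ x ∈ Function.periodicPts f := by
    obtain ⟨a, b, hab, h⟩ := Finite.exists_ne_map_eq_of_infinite fun m : ℕ => f^[m] x₀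
    wlog hlt : a < b generalizing a b
    · exact this b a hab.symm h.symm (by omega)
    refine ⟨_, ⟨a, rfl⟩, Function.mk_mem_periodicPts (Nat.sub_pos_of_lt hlt) ?_⟩
    change f^[b - a] (f^[a] x₀) = f^[a] x₀
    rw [← Function.iterate_add_apply, Nat.sub_add_cancel hlt.le]
    exact h.symm
  set x := f^[m] x₀ with hxm
  have hk := Function.minimalPeriod_pos_of_mem_periodicPts hx
  have : NeZero (Function.minimalPeriod f x) := ⟨hk.ne'⟩
  refine ⟨Function.minimalPeriod f x, fun a => f^[a.val] x, hk, ?_, ?_, ?_⟩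
  · intro a b hab
    exact ZMod.val_injective _ (Function.iterate_injOn_Iio_minimalPeriod
      (ZMod.val_lt a) (ZMod.val_lt b) hab)
  · intro a
    have h : (a + 1).val = (a.val + 1) % Function.minimalPeriod f x := by
      rw [← ZMod.val_natCast]; simp
    simp only [h, Function.iterate_mod_minimalPeriod_eq, Function.iterate_succ_apply']
  · intro a
    exact ⟨a.val + m, by rw [Function.iterate_add_apply]⟩

/-- A nonzero balanced network contains a cycle of positive edges. -/
lemma exists_positive_cycle {n : ℕ} {T : Matrix (Fin n) (Fin n) ℝ}
    (hT : ∀ i j, 0 ≤ T i j) (hTdiag : ∀ i, T i i = 0)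
    (hbal : ∀ i, (∑ j, T i j) - (∑ j, T j i) = 0) (hne : T ≠ 0) :
    ∃ (k : ℕ) (v : ZMod k → Fin n), 2 ≤ k ∧ Function.Injective v ∧
      ∀ a, 0 < T (v a) (v (a + 1)) := by
  have hout : ∀ i j, 0 < T i j → ∃ l, 0 < T j l := by
    intro i j hij
    have hcol : 0 < ∑ l, T l j :=
      Finset.sum_pos' (fun l _ => hT l j) ⟨i, Finset.mem_univ i, hij⟩
    by_contra! h
    have := Finset.sum_nonpos fun l (_ : l ∈ Finset.univ) => h l
    linarith [hbal j]
  obtain ⟨i₀, j₀, h₀⟩ : ∃ i j, 0 < T i j := by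
    by_contra! h
    exact hne (Matrix.ext fun i j => le_antisymm (h i j) (hT i j))
  have hf : ∀ i, ∃ j, (∃ l, 0 < T i l) → 0 < T i j := by
    intro i
    by_cases h : ∃ l, 0 < T i l
    · exact h.imp fun _ hl _ => hl
    · exact ⟨i, fun h' => absurd h' h⟩
  choose f hf using hf
  have hiter : ∀ m, ∃ l, 0 < T (f^[m] i₀) l := by
    intro m
    induction m with
    | zero => exact ⟨j₀, h₀⟩
    | succ m ih =>
      rw [Function.iterate_succ_apply']
      exact hout _ _ (hf _ ih)
  obtain ⟨k, v, hk, hv, hstep, horb⟩ := exists_injective_zmod_orbit f i₀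
  have hpos : ∀ a, 0 < T (v a) (v (a + 1)) := by
    intro a
    rw [hstep]
    obtain ⟨m, hm⟩ := horb a
    exact hf _ (hm ▸ hiter m)
  refine ⟨k, v, ?_, hv, hpos⟩
  by_contra hk2
  obtain rfl : k = 1 := by omega
  have h := hpos 0
  rw [Subsingleton.elim ((0 : ZMod 1) + 1) 0, hTdiag] at h
  exact h.false

/-- A balanced obligation network is composed of cycles only: if `T`
has nonnegative entries, zero diagonal, and zero net position at every node, then
`T` is a finite sum of cycle matrices with `k ≥ 2`, `v` injective and `p > 0`. -/
theorem balanced_network_is_sum_of_cycles {n : ℕ}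
    (T : Matrix (Fin n) (Fin n) ℝ)
    (hT : ∀ i j, 0 ≤ T i j) (hTdiag : ∀ i, T i i = 0)
    (hbal : ∀ i, (∑ j, T i j) - (∑ j, T j i) = 0) :
    ∃ cs : List ((k : ℕ) × (ZMod k → Fin n) × ℝ),
      (∀ c ∈ cs, 2 ≤ c.1 ∧ Function.Injective c.2.1 ∧ 0 < c.2.2) ∧
      T = (cs.map (fun c => cycleMatrix n c.1 c.2.1 c.2.2)).sum := by
  classical
  induction hN : (Finset.univ.filter fun e : Fin n × Fin n => T e.1 e.2 ≠ 0).card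
    using Nat.strong_induction_on generalizing T with
  | _ N ih =>
  by_cases hne : T = 0
  · exact ⟨[], by simp, by simpa using hne⟩
  obtain ⟨k, v, hk, hv, hpos⟩ := exists_positive_cycle hT hTdiag hbal hne
  have : NeZero k := ⟨by omega⟩
  obtain ⟨a₀, ha₀⟩ := Finite.exists_min fun a => T (v a) (v (a + 1))
  set p := T (v a₀) (v (a₀ + 1)) with hp
  set C := cycleMatrix n k v p with hC
  have hCle : ∀ i j, C i j ≤ T i j := by
    intro i j
    simp only [hC, cycleMatrix]
    split_ifs with h
    · obtain ⟨a, rfl, rfl⟩ := h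
      exact ha₀ a
    · exact hT i j
  have hC0 : ∀ i j, T i j = 0 → C i j = 0 := by
    intro i j hij
    refine if_neg ?_
    rintro ⟨a, rfl, rfl⟩
    exact (hpos a).ne' hij
  have hCa : C (v a₀) (v (a₀ + 1)) = p := if_pos ⟨a₀, rfl, rfl⟩
  have hcard : (Finset.univ.filter fun e : Fin n × Fin n => (T - C) e.1 e.2 ≠ 0).card < N := by
    rw [← hN]
    refine Finset.card_lt_card
      ((Finset.ssubset_iff_of_subset ?_).2 ⟨(v a₀, v (a₀ + 1)), ?_, ?_⟩)
    · intro e he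
      rw [Finset.mem_filter] at he ⊢
      exact ⟨he.1, fun h => he.2 (by rw [Matrix.sub_apply, h, hC0 _ _ h, sub_zero])⟩
    · simpa using (hpos a₀).ne'
    · rw [Finset.mem_filter]
      exact fun h => h.2 (by rw [Matrix.sub_apply, hCa, ← hp, sub_self])
  obtain ⟨cs, hcs, hsum⟩ := ih _ hcard (T - C)
    (fun i j => sub_nonneg.2 (hCle i j))
    (fun i => by rw [Matrix.sub_apply, hTdiag, hC0 i i (hTdiag i), sub_zero])
    (fun i => by
      simp only [Matrix.sub_apply, Finset.sum_sub_distrib]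
      linarith [hbal i, cycleMatrix_row_sum_eq_col_sum hv p i]) rfl
  refine ⟨⟨k, v, p⟩ :: cs, ?_, ?_⟩
  · intro c hc
    rcases List.mem_cons.1 hc with rfl | hc
    · exact ⟨hk, hv, hpos a₀⟩
    · exact hcs c hc
  · rw [List.map_cons, List.sum_cons, ← hsum]
    exact (add_sub_cancel C T).symm
end
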